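/- arXiv:2301.13070 — 2 statements merged into one kernel-verified Lean document; each statement's English description precedes it below -/
import Mathlib

section
/- Let χ₀ be a strongly continuous map from ℝ₊ = [0,∞) to the space B(L²(ℝ³)+L^∞(ℝ³), L¹(ℝ³)∩L²(ℝ³)) of bounded linear operators. Then there exists a unique strongly continuous map χ^RPA : ℝ₊ → B(L²+L^∞, L¹∩L²) satisfying the RPA Dyson equation χ^RPA(t) = χ₀(t) + ∫₀ᵗ χ₀(t−s) F_H χ^RPA(s) ds for all t ≥ 0, where F_H is the Hartree operator given by convolution against 1/|·| on ℝ³. -/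
/-!
STATEMENT 0: Existence and uniqueness of the solution of the RPA Dyson equation
`χ^RPA(t) = χ₀(t) + ∫₀ᵗ χ₀(t−s) F_H χ^RPA(s) ds`
in the space of strongly continuous maps from ℝ₊ to B(L²(ℝ³)+L^∞(ℝ³), L¹(ℝ³)∩L²(ℝ³)).
-/

open MeasureTheory ENNReal NNReal Complex
noncomputable section

/-- Euclidean space `ℝ³`. -/
abbrev R3 : Type := EuclideanSpace ℝ (Fin 3)

/-- The Lebesgue space `L^p(ℝ³; ℂ)`. -/
abbrev Lsp (p : ℝ≥0∞) : Type := Lp ℂ p (volume : Measure R3)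

/-- The Banach space `L¹(ℝ³) ∩ L²(ℝ³)` (with the max norm), realized as the submodule of
`L¹ × L²` of pairs whose two components agree almost everywhere. -/
def interSub : Submodule ℂ (Lsp 1 × Lsp 2) where
  carrier := {f | (f.1 : R3 → ℂ) =ᵐ[volume] (f.2 : R3 → ℂ)}
  add_mem' := by
    intro a b ha hb
    simp only [Set.mem_setOf_eq] at *
    have h1 := Lp.coeFn_add a.1 b.1
    have h2 := Lp.coeFn_add a.2 b.2
    filter_upwards [h1, h2, ha, hb] with x e1 e2 e3 e4
    show ((a.1 + b.1 : Lsp 1) : R3 → ℂ) x = ((a.2 + b.2 : Lsp 2) : R3 → ℂ) x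
    rw [e1, e2]
    simp [e3, e4]
  zero_mem' := by
    simp only [Set.mem_setOf_eq]
    have h1 := Lp.coeFn_zero ℂ 1 (volume : Measure R3)
    have h2 := Lp.coeFn_zero ℂ 2 (volume : Measure R3)
    filter_upwards [h1, h2] with x e1 e2
    show ((0 : Lsp 1) : R3 → ℂ) x = ((0 : Lsp 2) : R3 → ℂ) x
    rw [e1, e2]
  smul_mem' := by
    intro c a ha
    simp only [Set.mem_setOf_eq] at *
    have h1 := Lp.coeFn_smul c a.1
    have h2 := Lp.coeFn_smul c a.2
    filter_upwards [h1, h2, ha] with x e1 e2 e3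
    show ((c • a.1 : Lsp 1) : R3 → ℂ) x = ((c • a.2 : Lsp 2) : R3 → ℂ) x
    rw [e1, e2]
    simp [e3]

/-- The Banach space `L¹(ℝ³) ∩ L²(ℝ³)`. -/
abbrev L1capL2 : Type := ↥interSub

/-- The subspace of `L² × L^∞` of pairs summing to `0` a.e. (the "diagonal"). -/
def diagSub₀ : Submodule ℂ (Lsp 2 × Lsp ∞) where
  carrier := {f | (fun x => (f.1 : R3 → ℂ) x + (f.2 : R3 → ℂ) x) =ᵐ[volume] 0}
  add_mem' := by
    intro a b ha hb
    simp only [Set.mem_setOf_eq] at *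
    have h1 := Lp.coeFn_add a.1 b.1
    have h2 := Lp.coeFn_add a.2 b.2
    filter_upwards [h1, h2, ha, hb] with x e1 e2 e3 e4
    show ((a.1 + b.1 : Lsp 2) : R3 → ℂ) x + ((a.2 + b.2 : Lsp ∞) : R3 → ℂ) x = 0
    rw [e1, e2]
    have e3' : (a.1 : R3 → ℂ) x + (a.2 : R3 → ℂ) x = 0 := e3
    have e4' : (b.1 : R3 → ℂ) x + (b.2 : R3 → ℂ) x = 0 := e4
    simp only [Pi.add_apply]
    linear_combination e3' + e4'
  zero_mem' := by
    simp only [Set.mem_setOf_eq]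
    have h1 := Lp.coeFn_zero ℂ 2 (volume : Measure R3)
    have h2 := Lp.coeFn_zero ℂ ∞ (volume : Measure R3)
    filter_upwards [h1, h2] with x e1 e2
    show ((0 : Lsp 2) : R3 → ℂ) x + ((0 : Lsp ∞) : R3 → ℂ) x = 0
    rw [e1, e2]; simp
  smul_mem' := by
    intro c a ha
    simp only [Set.mem_setOf_eq] at *
    have h1 := Lp.coeFn_smul c a.1
    have h2 := Lp.coeFn_smul c a.2
    filter_upwards [h1, h2, ha] with x e1 e2 e3
    show ((c • a.1 : Lsp 2) : R3 → ℂ) x + ((c • a.2 : Lsp ∞) : R3 → ℂ) x = 0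
    rw [e1, e2]
    have e3' : (a.1 : R3 → ℂ) x + (a.2 : R3 → ℂ) x = 0 := e3
    simp only [Pi.smul_apply, smul_eq_mul]
    linear_combination c * e3'

/-- The closure of the diagonal (equal to it, since the diagonal is closed). -/
abbrev diagSub : Submodule ℂ (Lsp 2 × Lsp ∞) := diagSub₀.topologicalClosure

instance : IsClosed (diagSub : Set (Lsp 2 × Lsp ∞)) := diagSub₀.isClosed_topologicalClosure

/-- The Banach space `L²(ℝ³) + L^∞(ℝ³)` (with the quotient norm), realized as the quotient of
`L² × L^∞` by the diagonal. -/
abbrev L2plusLinf : Type := (Lsp 2 × Lsp ∞) ⧸ diagSub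

/-- The (isometric) inclusion `L¹ ∩ L² ↪ L¹ × L²`. -/
abbrev inclι : L1capL2 →L[ℂ] (Lsp 1 × Lsp 2) := interSub.subtypeL

/-- `F_H` is the Hartree operator, i.e. convolution against `1/|·|` on `ℝ³`; it is bounded
from `L¹ ∩ L²` to `L² + L^∞` by the Hardy–Littlewood–Sobolev inequality. -/
def IsHartree (FH : L1capL2 →L[ℂ] L2plusLinf) : Prop :=
  ∀ f : L1capL2, ∃ g : Lsp 2 × Lsp ∞,
    (Submodule.Quotient.mk g : L2plusLinf) = FH f ∧
    (fun x => (g.1 : R3 → ℂ) x + (g.2 : R3 → ℂ) x) =ᵐ[volume]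
      (fun x => ∫ y : R3, ((‖x - y‖ : ℂ))⁻¹ * ((f.1.1 : R3 → ℂ) y))

/-- Strong continuity of an operator-valued map on `ℝ₊`. -/
def SCont {E F : Type*} [SeminormedAddCommGroup E] [NormedSpace ℂ E]
    [SeminormedAddCommGroup F] [NormedSpace ℂ F] (χ : ℝ≥0 → (E →L[ℂ] F)) : Prop :=
  ∀ f : E, Continuous fun t => χ t f

/-- The RPA Dyson equation `χ(t) = χ₀(t) + ∫₀ᵗ χ₀(t−s) F_H χ(s) ds` for all `t ≥ 0`
(the integral being a Bochner integral, stated strongly). -/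
def SolvesDyson (FH : L1capL2 →L[ℂ] L2plusLinf)
    (χ₀ χ : ℝ≥0 → (L2plusLinf →L[ℂ] L1capL2)) : Prop :=
  ∀ (t : ℝ≥0) (f : L2plusLinf),
    IntervalIntegrable
      (fun s : ℝ => inclι (χ₀ (t - Real.toNNReal s) (FH (χ (Real.toNNReal s) f))))
      volume 0 (t : ℝ) ∧
    inclι (χ t f) = inclι (χ₀ t f) +
      ∫ s in (0:ℝ)..(t:ℝ), inclι (χ₀ (t - Real.toNNReal s) (FH (χ (Real.toNNReal s) f)))

section DysonAbstract

open Set Filter Topology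
open scoped BoundedContinuousFunction

variable {X Y : Type*} [SeminormedAddCommGroup X] [NormedSpace ℂ X]
  [NormedAddCommGroup Y] [NormedSpace ℂ Y]

theorem dys_joint (k : ℝ≥0 → (Y →L[ℂ] Y)) (hk : SCont k) (M : ℝ≥0) (hM : ∀ t, ‖k t‖ ≤ M) :
    Continuous (fun p : ℝ≥0 × Y => k p.1 p.2) := by
  refine continuous_prod_of_continuous_lipschitzWith' _ M (fun t => ?_) (fun y => hk y)
  exact (k t).lipschitz.weaken (by exact_mod_cast hM t)

/-- the integrand -/
theorem dys_integrand (k : ℝ≥0 → (Y →L[ℂ] Y)) (hk : SCont k) (M : ℝ≥0) (hM : ∀ t, ‖k t‖ ≤ M)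
    (u : ℝ≥0 → Y) (hu : Continuous u) (l : ℝ) :
    Continuous (Function.uncurry (fun (t : ℝ≥0) (s : ℝ) =>
      Real.exp (-l * ((t : ℝ) - s)) • k (t - s.toNNReal) (u s.toNNReal))) := by
  have h1 := dys_joint k hk M hM
  have h2 : Continuous (fun p : ℝ≥0 × ℝ => (p.1 - p.2.toNNReal, u p.2.toNNReal)) := by fun_prop
  have h3 := h1.comp h2
  have h4 : Continuous (fun p : ℝ≥0 × ℝ => Real.exp (-l * ((p.1 : ℝ) - p.2))) := by fun_prop
  exact h4.smul h3

theorem dys_exp_int (l t : ℝ) (hl : 0 < l) :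
    ∫ s in (0:ℝ)..t, Real.exp (-l * (t - s)) ≤ 1 / l := by
  have h : ∀ s ∈ uIcc 0 t, HasDerivAt (fun s => Real.exp (-l * (t - s)) / l)
      (Real.exp (-l * (t - s))) s := by
    intro s _
    have h1 : HasDerivAt (fun s : ℝ => -l * (t - s)) (-l * (0 - 1)) s :=
      ((hasDerivAt_const s t).sub (hasDerivAt_id s)).const_mul (-l)
    have h2 := h1.exp.div_const l
    have e : Real.exp (-l * (t - s)) * (-l * (0 - 1)) / l = Real.exp (-l * (t - s)) := by
      rw [div_eq_iff hl.ne']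
      ring
    rw [e] at h2
    exact h2
  rw [intervalIntegral.integral_eq_sub_of_hasDerivAt h
    (Continuous.intervalIntegrable (by fun_prop) _ _)]
  have : 0 < Real.exp (-l * (t - 0)) / l := by positivity
  have e : Real.exp (-l * (t - t)) / l = 1 / l := by simp
  rw [e]; linarith

theorem dys_bound (k : ℝ≥0 → (Y →L[ℂ] Y)) (M : ℝ≥0) (hM : ∀ t, ‖k t‖ ≤ M)
    (u : ℝ≥0 → Y) (C : ℝ) (hC : 0 ≤ C) (hu : ∀ t, ‖u t‖ ≤ C) (l : ℝ) (hl : 0 < l) (t : ℝ≥0) :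
    ‖∫ s in (0:ℝ)..t, Real.exp (-l * ((t : ℝ) - s)) • k (t - s.toNNReal) (u s.toNNReal)‖
      ≤ M / l * C := by
  have hi : IntervalIntegrable (fun s : ℝ => Real.exp (-l * ((t : ℝ) - s)) * (M * C))
      volume 0 (t : ℝ) := Continuous.intervalIntegrable (by fun_prop) _ _
  refine (intervalIntegral.norm_integral_le_of_norm_le t.2 (Eventually.of_forall ?_) hi).trans ?_
  · intro s _
    rw [norm_smul, Real.norm_of_nonneg (Real.exp_pos _).le]
    have : ‖k (t - s.toNNReal) (u s.toNNReal)‖ ≤ M * C :=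
      ((k _).le_opNorm _).trans (mul_le_mul (hM _) (hu _) (norm_nonneg _) M.2)
    gcongr
  · rw [intervalIntegral.integral_mul_const]
    have := dys_exp_int l t hl
    calc _ ≤ 1 / l * (M * C) := mul_le_mul_of_nonneg_right this (by positivity)
      _ = _ := by ring

/-- weighted Volterra operator -/
def dysV (k : ℝ≥0 → (Y →L[ℂ] Y)) (hk : SCont k) (M : ℝ≥0) (hM : ∀ t, ‖k t‖ ≤ M)
    (l : ℝ) (hl : 0 < l) : (ℝ≥0 →ᵇ Y) →L[ℂ] (ℝ≥0 →ᵇ Y) :=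
  LinearMap.mkContinuous
    { toFun := fun u => BoundedContinuousFunction.ofNormedAddCommGroup
        (fun t : ℝ≥0 => ∫ s in (0:ℝ)..t,
          Real.exp (-l * ((t : ℝ) - s)) • k (t - s.toNNReal) (u s.toNNReal))
        (intervalIntegral.continuous_parametric_intervalIntegral_of_continuous
          (dys_integrand k hk M hM u u.continuous l) NNReal.continuous_coe)
        (M / l * ‖u‖)
        (dys_bound k M hM u ‖u‖ (norm_nonneg _) u.norm_coe_le_norm l hl)
      map_add' := by
        intro u v
        ext t
        have hc : ∀ w : ℝ≥0 →ᵇ Y, IntervalIntegrable (fun s : ℝ =>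
            Real.exp (-l * ((t : ℝ) - s)) • k (t - s.toNNReal) (w s.toNNReal)) volume 0 t :=
          fun w => Continuous.intervalIntegrable
            ((dys_integrand k hk M hM w w.continuous l).comp
              (Continuous.prodMk_right t)) _ _
        simp only [BoundedContinuousFunction.coe_ofNormedAddCommGroup,
          BoundedContinuousFunction.coe_add, Pi.add_apply]
        rw [← intervalIntegral.integral_add (hc u) (hc v)]
        simp only [map_add, smul_add]
      map_smul' := by
        intro c u
        ext t
        simp only [BoundedContinuousFunction.coe_ofNormedAddCommGroup,
          BoundedContinuousFunction.coe_smul, RingHom.id_apply, map_smul]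
        rw [← intervalIntegral.integral_smul]
        simp only [smul_comm c] }
    (M / l) (by
      intro u
      refine (BoundedContinuousFunction.norm_le (by positivity)).2 ?_
      exact dys_bound k M hM u ‖u‖ (norm_nonneg _) u.norm_coe_le_norm l hl)

theorem dysV_apply (k : ℝ≥0 → (Y →L[ℂ] Y)) (hk : SCont k) (M : ℝ≥0) (hM : ∀ t, ‖k t‖ ≤ M)
    (l : ℝ) (hl : 0 < l) (u : ℝ≥0 →ᵇ Y) (t : ℝ≥0) :
    dysV k hk M hM l hl u t = ∫ s in (0:ℝ)..t,
          Real.exp (-l * ((t : ℝ) - s)) • k (t - s.toNNReal) (u s.toNNReal) := rfl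

theorem dysV_norm (k : ℝ≥0 → (Y →L[ℂ] Y)) (hk : SCont k) (M : ℝ≥0) (hM : ∀ t, ‖k t‖ ≤ M)
    (l : ℝ) (hl : 0 < l) : ‖dysV k hk M hM l hl‖ ≤ M / l :=
  LinearMap.mkContinuous_norm_le _ (by positivity) _

/-- weighted source -/
def dysG (g : ℝ≥0 → (X →L[ℂ] Y)) (hg : SCont g) (G : ℝ≥0) (hG : ∀ t, ‖g t‖ ≤ G)
    (l : ℝ) (hl : 0 < l) : X →L[ℂ] (ℝ≥0 →ᵇ Y) :=
  have hb : ∀ (f : X) (t : ℝ≥0), ‖Real.exp (-l * (t : ℝ)) • g t f‖ ≤ G * ‖f‖ := by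
    intro f t
    rw [norm_smul, Real.norm_of_nonneg (Real.exp_pos _).le]
    have h1 : Real.exp (-l * (t : ℝ)) ≤ 1 := Real.exp_le_one_iff.2 (by
      have : 0 ≤ l * (t : ℝ) := by positivity
      linarith)
    have h2 : ‖g t f‖ ≤ G * ‖f‖ := (g t).le_of_opNorm_le (hG t) f
    calc _ ≤ 1 * ‖g t f‖ := by gcongr
      _ ≤ _ := by rwa [one_mul]
  LinearMap.mkContinuous
    { toFun := fun f => BoundedContinuousFunction.ofNormedAddCommGroup
        (fun t : ℝ≥0 => Real.exp (-l * (t : ℝ)) • g t f)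
        (by
          have h1 := hg f
          have h2 : Continuous (fun t : ℝ≥0 => Real.exp (-l * (t : ℝ))) := by fun_prop
          exact h2.smul h1)
        (G * ‖f‖) (hb f)
      map_add' := by
        intro u v
        ext t
        simp
      map_smul' := by
        intro c u
        ext t
        simp [smul_comm c] }
    G (by
      intro u
      refine (BoundedContinuousFunction.norm_le (by positivity)).2 ?_
      exact hb u)

theorem dysG_apply (g : ℝ≥0 → (X →L[ℂ] Y)) (hg : SCont g) (G : ℝ≥0) (hG : ∀ t, ‖g t‖ ≤ G)
    (l : ℝ) (hl : 0 < l) (f : X) (t : ℝ≥0) :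
    dysG g hg G hG l hl f t = Real.exp (-l * (t : ℝ)) • g t f := rfl

theorem dys_exists_bdd [CompleteSpace Y] (k : ℝ≥0 → (Y →L[ℂ] Y)) (hk : SCont k) (M : ℝ≥0)
    (hM : ∀ t, ‖k t‖ ≤ M) (g : ℝ≥0 → (X →L[ℂ] Y)) (hg : SCont g) (G : ℝ≥0)
    (hG : ∀ t, ‖g t‖ ≤ G) :
    ∃ u : ℝ≥0 → (X →L[ℂ] Y), SCont u ∧ ∀ (t : ℝ≥0) (f : X),
      u t f = g t f + ∫ s in (0:ℝ)..t, k (t - s.toNNReal) (u s.toNNReal f) := by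
  set l : ℝ := M + 1 with hl'
  have hl : 0 < l := by positivity
  have hV : ‖dysV k hk M hM l hl‖ < 1 :=
    (dysV_norm k hk M hM l hl).trans_lt (by rw [div_lt_one hl]; linarith)
  set V := dysV k hk M hM l hl with hVdef
  set Gm := dysG g hg G hG l hl with hGdef
  let R : (ℝ≥0 →ᵇ Y) →L[ℂ] (ℝ≥0 →ᵇ Y) := ((Units.oneSub V hV)⁻¹ : Units _).1
  have hR : ∀ w, R w = w + V (R w) := by
    intro w
    have h1 : (1 - V) * R = 1 := (Units.oneSub V hV).mul_inv
    have h2 : R w - V (R w) = w := DFunLike.congr_fun h1 w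
    exact sub_eq_iff_eq_add.1 h2
  let ev : ℝ≥0 → ((ℝ≥0 →ᵇ Y) →L[ℂ] Y) := fun t => BoundedContinuousFunction.evalCLM ℂ t
  refine ⟨fun t => ((Real.exp (l * (t:ℝ)) : ℝ) : ℂ) • (ev t).comp (R.comp Gm), ?_, ?_⟩
  · intro f
    have h1 : Continuous (fun t : ℝ≥0 => ((Real.exp (l * (t:ℝ)) : ℝ) : ℂ)) := by fun_prop
    exact h1.smul (R (Gm f)).continuous
  · intro t f
    have h1 : R (Gm f) t = Gm f t + V (R (Gm f)) t := DFunLike.congr_fun (hR (Gm f)) t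
    rw [hVdef, dysV_apply, hGdef, dysG_apply, ← hGdef] at h1
    have ev' : ∀ (t : ℝ≥0), (((Real.exp (l * (t:ℝ)) : ℝ) : ℂ) • (ev t).comp (R.comp Gm)) f
      = Real.exp (l * (t:ℝ)) • R (Gm f) t := fun t => rfl
    simp only [ev']
    rw [h1, smul_add, smul_smul, ← Real.exp_add, ← intervalIntegral.integral_smul]
    congr 1
    · simp
    · refine intervalIntegral.integral_congr fun s hs => ?_
      rw [uIcc_of_le (NNReal.coe_nonneg t)] at hs
      have e : ((s.toNNReal : ℝ≥0) : ℝ) = s := Real.coe_toNNReal s hs.1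
      simp only [e]
      rw [smul_smul, ← Real.exp_add]
      have : l * (t : ℝ) + -l * ((t : ℝ) - s) = l * s := by ring
      rw [this]
      exact ((k (t - s.toNNReal)).map_smul_of_tower (Real.exp (l * s)) _).symm

theorem dys_unique (k : ℝ≥0 → (Y →L[ℂ] Y)) (M T : ℝ≥0)
    (hM : ∀ t ≤ T, ‖k t‖ ≤ M) (w : ℝ≥0 → Y) (hw : Continuous w)
    (h : ∀ t ≤ T, w t = ∫ s in (0:ℝ)..t, k (t - s.toNNReal) (w s.toNNReal)) :
    ∀ t ≤ T, w t = 0 := by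
  let φ : ℝ → ℝ := fun s => ‖w s.toNNReal‖
  have hφ : Continuous φ := by fun_prop
  have hφ0 : ∀ s, 0 ≤ φ s := fun s => norm_nonneg _
  let Φ : ℝ → ℝ := fun t => ∫ s in (0:ℝ)..t, φ s
  have hΦ : ∀ t, HasDerivAt Φ (φ t) t := fun t => hφ.integral_hasStrictDerivAt 0 t |>.hasDerivAt
  have key : ∀ t : ℝ, 0 ≤ t → t ≤ T → φ t ≤ M * Φ t := by
    intro t h0 hT
    have hT' : t.toNNReal ≤ T := Real.toNNReal_le_iff_le_coe.2 hT
    have e : ((t.toNNReal : ℝ≥0) : ℝ) = t := Real.coe_toNNReal t h0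
    have h1 := h _ hT'
    rw [e] at h1
    change ‖w t.toNNReal‖ ≤ _
    rw [h1]
    change _ ≤ M * ∫ s in (0:ℝ)..t, φ s
    rw [← intervalIntegral.integral_const_mul]
    refine intervalIntegral.norm_integral_le_of_norm_le h0 (Eventually.of_forall ?_)
      (Continuous.intervalIntegrable (by fun_prop) _ _)
    intro s _
    exact (k _).le_of_opNorm_le (hM _ (tsub_le_self.trans hT')) _
  have z : ∀ x ∈ Icc (0:ℝ) T, Φ x = 0 := by
    refine eq_zero_of_abs_deriv_le_mul_abs_self_of_eq_zero_right (f' := φ) (K := M)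
      (fun x _ => (hΦ x).continuousAt.continuousWithinAt)
      (fun x _ => (hΦ x).hasDerivWithinAt) (by simp [Φ]) ?_
    intro x hx
    have h1 := key x hx.1 hx.2.le
    have h2 : 0 ≤ Φ x := intervalIntegral.integral_nonneg hx.1 (fun s _ => hφ0 s)
    rw [Real.norm_of_nonneg h2, Real.norm_of_nonneg (hφ0 x)]
    exact h1
  intro t ht
  have h1 := key t t.2 (by exact_mod_cast ht)
  rw [z t ⟨t.2, by exact_mod_cast ht⟩, mul_zero] at h1
  have h2 : φ t = ‖w t‖ := by simp [φ]
  rw [h2] at h1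
  exact norm_le_zero_iff.1 h1

theorem dys_loc_bdd {E F : Type*} [SeminormedAddCommGroup E] [NormedSpace ℂ E] [CompleteSpace E]
    [NormedAddCommGroup F] [NormedSpace ℂ F] (χ : ℝ≥0 → (E →L[ℂ] F)) (hχ : SCont χ) (T : ℝ≥0) :
    ∃ M : ℝ≥0, ∀ t ≤ T, ‖χ t‖ ≤ M := by
  obtain ⟨C, hC⟩ := banach_steinhaus (g := fun t : Icc 0 T => χ t) (by
    intro x
    obtain ⟨C, hC⟩ := (isCompact_Icc (a := (0:ℝ≥0)) (b := T)).exists_bound_of_continuousOn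
      (hχ x).continuousOn
    exact ⟨C, fun i => hC i i.2⟩)
  exact ⟨C.toNNReal, fun t ht => (hC ⟨t, zero_le, ht⟩).trans (Real.le_coe_toNNReal C)⟩

/-- integrand continuity on the relevant interval, only locally bounded kernel -/
theorem dys_intble [CompleteSpace Y] (k : ℝ≥0 → (Y →L[ℂ] Y)) (hk : SCont k) (u : ℝ≥0 → Y)
    (hu : Continuous u) (t : ℝ≥0) :
    Continuous (fun s : ℝ => k (t - s.toNNReal) (u s.toNNReal)) := by
  obtain ⟨M, hM⟩ := dys_loc_bdd k hk t
  have h1 := dys_joint (fun s => k (min s t)) (fun f => (hk f).comp (by fun_prop)) M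
    (fun s => hM _ (min_le_right _ _))
  have h2 : Continuous (fun s : ℝ => (t - s.toNNReal, u s.toNNReal)) := by fun_prop
  have h3 := h1.comp h2
  convert h3 using 2 with s
  simp

theorem dys_main [CompleteSpace X] [CompleteSpace Y] (A : Y →L[ℂ] X)
    (χ₀ : ℝ≥0 → (X →L[ℂ] Y)) (hχ₀ : SCont χ₀) :
    (∃ χ : ℝ≥0 → (X →L[ℂ] Y), SCont χ ∧ ∀ (t : ℝ≥0) (f : X),
      χ t f = χ₀ t f + ∫ s in (0:ℝ)..t, χ₀ (t - s.toNNReal) (A (χ s.toNNReal f))) ∧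
    (∀ χ χ' : ℝ≥0 → (X →L[ℂ] Y), SCont χ → SCont χ' →
      (∀ (t : ℝ≥0) (f : X),
        χ t f = χ₀ t f + ∫ s in (0:ℝ)..t, χ₀ (t - s.toNNReal) (A (χ s.toNNReal f))) →
      (∀ (t : ℝ≥0) (f : X),
        χ' t f = χ₀ t f + ∫ s in (0:ℝ)..t, χ₀ (t - s.toNNReal) (A (χ' s.toNNReal f))) →
      χ = χ') := by
  let k : ℝ≥0 → (Y →L[ℂ] Y) := fun t => (χ₀ t).comp A
  have hk : SCont k := fun f => hχ₀ (A f)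
  have uniq : ∀ (T : ℝ≥0) (f : X) (u v : ℝ≥0 → Y), Continuous u → Continuous v →
      (∀ t ≤ T, u t = χ₀ t f + ∫ s in (0:ℝ)..t, k (t - s.toNNReal) (u s.toNNReal)) →
      (∀ t ≤ T, v t = χ₀ t f + ∫ s in (0:ℝ)..t, k (t - s.toNNReal) (v s.toNNReal)) →
      ∀ t ≤ T, u t = v t := by
    intro T f u v hu hv h1 h2 t ht
    obtain ⟨M, hM⟩ := dys_loc_bdd k hk T
    refine sub_eq_zero.1 (dys_unique k M T hM (fun t => u t - v t) (hu.sub hv) ?_ t ht)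
    intro t ht
    simp only [map_sub]
    rw [intervalIntegral.integral_sub ((dys_intble k hk u hu t).intervalIntegrable _ _)
      ((dys_intble k hk v hv t).intervalIntegrable _ _)]
    nth_rewrite 1 [h1 t ht, h2 t ht]
    abel
  constructor
  · have ex : ∀ T : ℝ≥0, ∃ u : ℝ≥0 → (X →L[ℂ] Y), SCont u ∧ ∀ t ≤ T, ∀ (f : X),
        u t f = χ₀ t f + ∫ s in (0:ℝ)..t, k (t - s.toNNReal) (u s.toNNReal f) := by
      intro T
      obtain ⟨M, hM⟩ := dys_loc_bdd k hk T
      obtain ⟨G, hG⟩ := dys_loc_bdd χ₀ hχ₀ T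
      obtain ⟨u, hu, hu2⟩ := dys_exists_bdd (fun s => k (min s T))
        (fun f => (hk f).comp (by fun_prop)) M (fun s => hM _ (min_le_right _ _))
        (fun s => χ₀ (min s T)) (fun f => (hχ₀ f).comp (by fun_prop)) G
        (fun s => hG _ (min_le_right _ _))
      refine ⟨u, hu, fun t ht f => ?_⟩
      rw [hu2 t f, min_eq_left ht]
      congr 1
      refine intervalIntegral.integral_congr fun s _ => ?_
      have : t - s.toNNReal ≤ T := tsub_le_self.trans ht
      simp only [min_eq_left this]
    choose U hU1 hU2 using ex
    have agree : ∀ (T T' t : ℝ≥0) (f : X), t ≤ T → t ≤ T' → U T t f = U T' t f := by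
      intro T T' t f h h'
      exact uniq t f (fun s => U T s f) (fun s => U T' s f) (hU1 T f) (hU1 T' f)
        (fun s hs => hU2 T s (hs.trans h) f) (fun s hs => hU2 T' s (hs.trans h') f) t le_rfl
    refine ⟨fun t => U t t, ?_, ?_⟩
    · intro f
      rw [continuous_iff_continuousAt]
      intro t
      refine ((hU1 (t + 1) f).continuousAt (x := t)).congr ?_
      have : ∀ᶠ s in 𝓝 t, s < t + 1 := gt_mem_nhds (lt_add_one t)
      filter_upwards [this] with s hs
      exact agree _ _ _ _ hs.le le_rfl
    · intro t f
      rw [hU2 t t le_rfl f]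
      congr 1
      refine intervalIntegral.integral_congr fun s hs => ?_
      rw [uIcc_of_le (NNReal.coe_nonneg t)] at hs
      have e := agree t s.toNNReal s.toNNReal f (Real.toNNReal_le_iff_le_coe.2 hs.2) le_rfl
      simp only [e]
      rfl
  · intro χ χ' h h' h1 h2
    ext1 t
    ext1 f
    exact uniq t f (fun s => χ s f) (fun s => χ' s f) (h f) (h' f) (fun s _ => h1 s f)
      (fun s _ => h2 s f) t le_rfl

end DysonAbstract

theorem interSub_isClosed : IsClosed (interSub : Set (Lsp 1 × Lsp 2)) := by
  rw [← isSeqClosed_iff_isClosed]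
  intro x p hx hp
  have h1 := tendstoInMeasure_of_tendsto_Lp ((continuous_fst.tendsto p).comp hp)
  have h2 := tendstoInMeasure_of_tendsto_Lp ((continuous_snd.tendsto p).comp hp)
  have h3 : TendstoInMeasure volume (fun n => ((x n).1 : R3 → ℂ)) Filter.atTop (p.2 : R3 → ℂ) :=
    h2.congr_left (fun n => by
      have h : ((x n).1 : R3 → ℂ) =ᵐ[volume] ((x n).2 : R3 → ℂ) := hx n
      exact h.symm)
  exact tendstoInMeasure_ae_unique h1 h3

instance dysCompl : CompleteSpace L1capL2 := interSub_isClosed.completeSpace_coe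

/-- Theorem 1.1 (i): for every strongly continuous
`χ₀ : ℝ₊ → B(L²+L^∞, L¹∩L²)` there is a unique strongly continuous solution `χ^RPA` of the
RPA Dyson equation. -/
theorem rpa_dyson_existence_uniqueness
    (FH : L1capL2 →L[ℂ] L2plusLinf) (hFH : IsHartree FH)
    (χ₀ : ℝ≥0 → (L2plusLinf →L[ℂ] L1capL2)) (hχ₀ : SCont χ₀) :
    ∃! χRPA : ℝ≥0 → (L2plusLinf →L[ℂ] L1capL2),
      SCont χRPA ∧ SolvesDyson FH χ₀ χRPA := by
  obtain ⟨⟨χ, hχ, hχ2⟩, hun⟩ := dys_main FH χ₀ hχ₀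
  have hint : ∀ (ψ : ℝ≥0 → (L2plusLinf →L[ℂ] L1capL2)), SCont ψ → ∀ (t : ℝ≥0) (f : L2plusLinf),
      IntervalIntegrable (fun s : ℝ => χ₀ (t - Real.toNNReal s) (FH (ψ (Real.toNNReal s) f)))
        volume 0 (t : ℝ) := fun ψ hψ t f =>
    (dys_intble (fun t => (χ₀ t).comp FH) (fun f => hχ₀ (FH f)) (fun s => ψ s f)
      (hψ f) t).intervalIntegrable _ _
  have hcomm : ∀ (ψ : ℝ≥0 → (L2plusLinf →L[ℂ] L1capL2)), SCont ψ → ∀ (t : ℝ≥0) (f : L2plusLinf),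
      ∫ s in (0:ℝ)..(t:ℝ), inclι (χ₀ (t - Real.toNNReal s) (FH (ψ (Real.toNNReal s) f))) =
      inclι (∫ s in (0:ℝ)..(t:ℝ), χ₀ (t - Real.toNNReal s) (FH (ψ (Real.toNNReal s) f))) :=
    fun ψ hψ t f => ContinuousLinearMap.intervalIntegral_comp_comm inclι (hint ψ hψ t f)
  refine ⟨χ, ⟨hχ, fun t f => ⟨?_, ?_⟩⟩, ?_⟩
  · have h := hint χ hχ t f
    exact ⟨inclι.integrable_comp h.1, inclι.integrable_comp h.2⟩
  · rw [hcomm χ hχ t f, ← map_add]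
    exact congrArg inclι (hχ2 t f)
  · rintro ψ ⟨hψ, hψ2⟩
    refine hun ψ χ hψ hχ (fun t f => ?_) hχ2
    have h := (hψ2 t f).2
    rw [hcomm ψ hψ t f, ← map_add] at h
    exact Subtype.coe_injective h

end
end

section
/- Let H be a self-adjoint Hamiltonian of the form H = −½Δ + Σ_{1≤i<j≤N} w(r_i−r_j) + Σ_{i=1}^N v(r_i) on H_N = ⋀^N L²(ℝ³) with v, w ∈ L²(ℝ³)+L^∞(ℝ³) real-valued, let Ψ₀ be a ground state of H, let H(t) = H + ε θ(t) f(t) V_P with V_P a bounded multiplication operator on H_N, f ∈ L^∞(ℝ), ε ∈ ℝ, and let Ψ(t) solve i∂_t Ψ(t) = H(t)Ψ(t), Ψ(0) = Ψ₀. Then for any bounded multiplication operator V_O on H_N, the expectation value ⟨V_O⟩_t = ⟨Ψ(t), V_O Ψ(t)⟩ satisfies ⟨V_O⟩_t − ⟨V_O⟩_0 = iε ∫_{−∞}^{∞} θ(t−t′) f(t′) ⟨Ψ₀, [V_P, (V_O)_I(t−t′)] Ψ₀⟩ dt′ + O(ε²) as ε → 0, where (V_O)_I(τ) = e^{iτH}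 V_O e^{−iτH} and [A,B] = AB − BA. -/
/-!
STATEMENT 6 (Proposition 2.1, Kubo formula): first-order perturbation expansion of the
expectation value `⟨V_O⟩_t = ⟨Ψ(t), V_O Ψ(t)⟩` for the solution of the time-dependent
Schrödinger equation with Hamiltonian `H(t) = H + ε θ(t) f(t) V_P`.

The self-adjoint Hamiltonian `H` (which for a molecule is
`H = −½Δ + Σ_{i<j} w(r_i−r_j) + Σ_i v(r_i)` acting on `⋀^N L²(ℝ³)`) enters through the
strongly continuous unitary group `U(t) = e^{−itH}` that it generates; `(V_O)_I(τ) =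
e^{iτH} V_O e^{−iτH} = U(−τ) V_O U(τ)`.  The solution `Ψ(t)` is encoded through its Duhamel
formula.  (Note `θ(t−t′)·θ(t′) = 1` on the effective integration domain `(0,t]`.)
-/

open MeasureTheory Complex
open scoped InnerProductSpace
noncomputable section

/-- The Heaviside function. -/
def heaviside (t : ℝ) : ℝ := if 0 ≤ t then 1 else 0

theorem kubo_formula
    {𝓗 : Type*} [NormedAddCommGroup 𝓗] [InnerProductSpace ℂ 𝓗] [CompleteSpace 𝓗]
    -- the strongly continuous unitary group `U(t) = e^{−itH}` generated by `H`
    (U : ℝ → (𝓗 →L[ℂ] 𝓗))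
    (hU0 : U 0 = ContinuousLinearMap.id ℂ 𝓗)
    (hUgrp : ∀ s t : ℝ, U (s + t) = U s ∘L U t)
    (hUunit : ∀ (t : ℝ) (x y : 𝓗), ⟪U t x, U t y⟫_ℂ = ⟪x, y⟫_ℂ)
    (hUcont : ∀ x : 𝓗, Continuous fun t => U t x)
    -- the ground state `Ψ₀` of `H`, with energy `E₀`
    (E₀ : ℝ) (Ψ₀ : 𝓗) (hΨ₀ : ‖Ψ₀‖ = 1)
    (hgs : ∀ t : ℝ, U t Ψ₀ = Complex.exp (-(Complex.I * E₀ * t)) • Ψ₀)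
    -- the bounded (self-adjoint) multiplication operators `V_P` and `V_O`
    (VP VO : 𝓗 →L[ℂ] 𝓗) (hVP : IsSelfAdjoint VP) (hVO : IsSelfAdjoint VO)
    -- the bounded time profile `f`
    (f : ℝ → ℝ) (hfm : Measurable f) (hfb : ∃ Cf : ℝ, ∀ s, |f s| ≤ Cf)
    -- for each `ε`, the solution `Ψ(t)` of `i∂_tΨ = (H + εθ(t)f(t)V_P)Ψ`, `Ψ(0) = Ψ₀`,
    -- given by the Duhamel formula
    (Ψ : ℝ → ℝ → 𝓗) (hΨcont : ∀ ε : ℝ, Continuous (Ψ ε))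
    (hduh : ∀ (ε : ℝ) (t : ℝ), Ψ ε t = U t Ψ₀ -
      Complex.I • ∫ s in (0:ℝ)..t,
        U (t - s) (((ε * heaviside s * f s : ℝ) : ℂ) • VP (Ψ ε s))) :
    -- conclusion: `⟨V_O⟩_t − ⟨V_O⟩_0 = iε ∫ θ(t−t′) f(t′) ⟨Ψ₀, [V_P, (V_O)_I(t−t′)] Ψ₀⟩ dt′
    --              + O(ε²)` as `ε → 0`
    ∀ t : ℝ, 0 ≤ t → ∃ C > 0, ∃ ε₀ > 0, ∀ ε : ℝ, |ε| ≤ ε₀ →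
      ‖⟪Ψ ε t, VO (Ψ ε t)⟫_ℂ - ⟪Ψ ε 0, VO (Ψ ε 0)⟫_ℂ -
        Complex.I * (ε : ℂ) * ∫ t' in Set.Ioc (0:ℝ) t,
          ((heaviside (t - t') * f t' : ℝ) : ℂ) *
            ⟪Ψ₀, ((VP ∘L (U (-(t - t')) ∘L VO ∘L U (t - t'))) -
              ((U (-(t - t')) ∘L VO ∘L U (t - t')) ∘L VP)) Ψ₀⟫_ℂ‖ ≤ C * ε ^ 2 := by
  intro t ht
  obtain ⟨Cf, hCf⟩ := hfb
  have hCf0 : 0 ≤ Cf := (abs_nonneg _).trans (hCf 0)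
  have hnorm : ∀ (τ : ℝ) (x : 𝓗), ‖U τ x‖ = ‖x‖ := fun τ x => by
    have h := hUunit τ x x
    rw [inner_self_eq_norm_sq_to_K, inner_self_eq_norm_sq_to_K] at h
    have h2 : ‖U τ x‖ ^ 2 = ‖x‖ ^ 2 := by exact_mod_cast h
    exact (sq_eq_sq₀ (norm_nonneg _) (norm_nonneg _)).1 h2
  have hUU : ∀ (τ : ℝ) (x : 𝓗), U τ (U (-τ) x) = x := fun τ x => by
    have h := hUgrp τ (-τ)
    rw [add_neg_cancel, hU0] at h
    exact (congrArg (fun T : 𝓗 →L[ℂ] 𝓗 => T x) h).symm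
  have hadj : ∀ (τ : ℝ) (x y : 𝓗), ⟪x, U (-τ) y⟫_ℂ = ⟪U τ x, y⟫_ℂ := fun τ x y => by
    rw [← hUunit τ x, hUU]
  have hP : ∀ x y : 𝓗, ⟪VP x, y⟫_ℂ = ⟪x, VP y⟫_ℂ := fun x y => by
    rw [← ContinuousLinearMap.adjoint_inner_right, hVP.adjoint_eq]
  have hO : ∀ x y : 𝓗, ⟪VO x, y⟫_ℂ = ⟪x, VO y⟫_ℂ := fun x y => by
    rw [← ContinuousLinearMap.adjoint_inner_right, hVO.adjoint_eq]
  -- joint continuity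
  have hjc : ∀ (r : ℝ) (φ : ℝ → 𝓗), Continuous φ → Continuous fun s => U (r - s) (φ s) := by
    intro r φ hφ
    rw [continuous_iff_continuousAt]
    intro s₀
    have h1 : Filter.Tendsto (fun s => U (r - s) (φ s₀)) (nhds s₀) (nhds (U (r - s₀) (φ s₀))) :=
      ((hUcont (φ s₀)).comp (continuous_const.sub continuous_id)).tendsto s₀
    have h2 : Filter.Tendsto (fun s => U (r - s) (φ s - φ s₀)) (nhds s₀) (nhds 0) := by
      rw [tendsto_zero_iff_norm_tendsto_zero]
      simp only [hnorm]
      rw [← tendsto_zero_iff_norm_tendsto_zero]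
      have := tendsto_sub_nhds_zero_iff.2 (hφ.tendsto s₀)
      exact this
    have h3 := h1.add h2
    simpa [ContinuousAt] using h3
  -- integrability
  have hint : ∀ (r : ℝ) (φ : ℝ → 𝓗), Continuous φ →
      IntegrableOn (fun s => ((f s : ℝ) : ℂ) • U (r - s) (VP (φ s))) (Set.Ioc 0 r) := by
    intro r φ hφ
    have hc := hjc r (fun s => VP (φ s)) (VP.continuous.comp hφ)
    have hi : IntegrableOn (fun s => U (r - s) (VP (φ s))) (Set.Ioc 0 r) :=
      (hc.integrableOn_Icc (a := 0) (b := r)).mono_set Set.Ioc_subset_Icc_self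
    refine Integrable.bdd_smul hi Cf
      (Complex.measurable_ofReal.comp hfm).aestronglyMeasurable ?_
    exact Filter.Eventually.of_forall fun s => by simpa using hCf s
  have hduh' : ∀ (ε r : ℝ), 0 ≤ r → Ψ ε r = U r Ψ₀ - (Complex.I * ε) •
      ∫ s in Set.Ioc (0:ℝ) r, ((f s : ℝ) : ℂ) • U (r - s) (VP (Ψ ε s)) := by
    intro ε r hr
    conv_lhs => rw [hduh ε r]
    rw [intervalIntegral.integral_of_le hr, mul_smul, ← integral_smul (ε : ℂ)]
    congr 2
    refine setIntegral_congr_fun measurableSet_Ioc fun s hs => ?_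
    simp [heaviside, hs.1.le, mul_smul]
  set B : ℝ := Cf * ‖VP‖ with hB
  have hB0 : 0 ≤ B := mul_nonneg hCf0 (norm_nonneg _)
  have hbd : ∀ (r : ℝ) (φ : ℝ → 𝓗) (M : ℝ), 0 ≤ r → r ≤ t → 0 ≤ M →
      (∀ s ∈ Set.Icc 0 t, ‖φ s‖ ≤ M) →
      ‖∫ s in Set.Ioc (0:ℝ) r, ((f s : ℝ) : ℂ) • U (r - s) (VP (φ s))‖ ≤ B * M * t := by
    intro r φ M hr hrt hM h
    have := norm_setIntegral_le_of_norm_le_const (μ := volume) (s := Set.Ioc (0:ℝ) r)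
      (f := fun s => ((f s : ℝ) : ℂ) • U (r - s) (VP (φ s))) (C := B * M) (by simp)
      (fun s hs => by
        rw [norm_smul, hnorm, Complex.norm_real, Real.norm_eq_abs, hB, mul_assoc]
        gcongr
        · exact hCf s
        · exact (VP.le_opNorm _).trans (by
            gcongr; exact h s ⟨hs.1.le, hs.2.trans hrt⟩))
    refine this.trans ?_
    simp only [Measure.real, Real.volume_Ioc, sub_zero, ENNReal.toReal_ofReal hr]
    gcongr
  set A : ℝ := B * t with hA
  have hA0 : 0 ≤ A := mul_nonneg hB0 ht
  have hlin : ∀ x : 𝓗, ‖VO x‖ ≤ ‖VO‖ * ‖x‖ := VO.le_opNorm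
  refine ⟨8 * ‖VO‖ * A ^ 2 + 1, by positivity, 1 / (2 * (A + 1)), by positivity, ?_⟩
  intro ε hε
  have hεA : |ε| * A ≤ 1 / 2 := by
    rw [le_div_iff₀ (by positivity)] at hε
    nlinarith [abs_nonneg ε]
  -- a priori bound
  have hM : ∀ s ∈ Set.Icc 0 t, ‖Ψ ε s‖ ≤ 2 := by
    obtain ⟨s₀, hs₀, hmax⟩ := isCompact_Icc.exists_isMaxOn (Set.nonempty_Icc.2 ht)
      (hΨcont ε).norm.continuousOn
    have hmax' : ∀ s ∈ Set.Icc 0 t, ‖Ψ ε s‖ ≤ ‖Ψ ε s₀‖ := fun s hs => hmax hs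
    have h1 := hbd s₀ (Ψ ε) _ hs₀.1 hs₀.2 (norm_nonneg _) hmax'
    have h2 : ‖Ψ ε s₀‖ ≤ 1 + |ε| * (B * ‖Ψ ε s₀‖ * t) := by
      conv_lhs => rw [hduh' ε s₀ hs₀.1]
      refine (norm_sub_le _ _).trans ?_
      rw [hnorm, hΨ₀, norm_smul, norm_mul, Complex.norm_I, one_mul, Complex.norm_real,
        Real.norm_eq_abs]
      gcongr
    have h3 : ‖Ψ ε s₀‖ ≤ 2 := by
      have : |ε| * (B * ‖Ψ ε s₀‖ * t) = (|ε| * A) * ‖Ψ ε s₀‖ := by rw [hA]; ring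
      nlinarith [norm_nonneg (Ψ ε s₀)]
    exact fun s hs => (hmax' s hs).trans h3
  have hD : ∀ s ∈ Set.Icc 0 t, ‖Ψ ε s - U s Ψ₀‖ ≤ 2 * (|ε| * A) := by
    intro s hs
    have h1 := hbd s (Ψ ε) 2 hs.1 hs.2 (by norm_num) hM
    conv_lhs => rw [hduh' ε s hs.1]
    rw [sub_sub_cancel_left, norm_neg, norm_smul, norm_mul, Complex.norm_I, one_mul,
      Complex.norm_real, Real.norm_eq_abs]
    calc |ε| * _ ≤ |ε| * (B * 2 * t) := by gcongr
      _ = _ := by rw [hA]; ring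
  set Φ := U t Ψ₀ with hΦ
  set X := ∫ s in Set.Ioc (0:ℝ) t, ((f s : ℝ) : ℂ) • U (t - s) (VP (U s Ψ₀)) with hX
  set δ : 𝓗 := -((Complex.I * ε) • X) with hδ
  set D : 𝓗 := Ψ ε t - Φ with hDdef
  have hDn : ‖D‖ ≤ 2 * (|ε| * A) := hD t ⟨ht, le_rfl⟩
  have hR : ‖D - δ‖ ≤ 2 * (|ε| * A) ^ 2 := by
    have h1 := hbd t (fun s => Ψ ε s - U s Ψ₀) _ ht le_rfl (by positivity) hD
    have h2 : D - δ = -((Complex.I * ε) •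
        ∫ s in Set.Ioc (0:ℝ) t, ((f s : ℝ) : ℂ) • U (t - s) (VP (Ψ ε s - U s Ψ₀))) := by
      have : D = -((Complex.I * ε) •
          ∫ s in Set.Ioc (0:ℝ) t, ((f s : ℝ) : ℂ) • U (t - s) (VP (Ψ ε s))) := by
        rw [hDdef]
        conv_lhs => rw [hduh' ε t ht]
        rw [sub_sub_cancel_left]
      rw [this, hδ, neg_sub_neg, ← neg_sub, ← smul_sub, hX,
        ← integral_sub (hint t _ (hΨcont ε)) (hint t _ (hUcont Ψ₀))]
      simp only [map_sub, smul_sub]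
    rw [h2, norm_neg, norm_smul, norm_mul, Complex.norm_I, one_mul,
      Complex.norm_real, Real.norm_eq_abs]
    calc |ε| * _ ≤ |ε| * (B * (2 * (|ε| * A)) * t) := by gcongr
      _ = _ := by rw [hA]; ring
  have hΦn : ‖Φ‖ = 1 := by rw [hΦ, hnorm, hΨ₀]
  have hΨε0 : Ψ ε 0 = Ψ₀ := by
    rw [hduh ε 0]; simp [hU0]
  have hph : ∀ s : ℝ, starRingEnd ℂ (Complex.exp (-(Complex.I * E₀ * s))) *
      Complex.exp (-(Complex.I * E₀ * s)) = 1 := fun s => by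
    rw [← Complex.exp_conj, ← Complex.exp_add]
    simp
  have h0 : ⟪Ψ ε 0, VO (Ψ ε 0)⟫_ℂ = ⟪Φ, VO Φ⟫_ℂ := by
    rw [hΨε0, hΦ, hgs t, map_smul, inner_smul_left, inner_smul_right, ← mul_assoc, hph, one_mul]
  -- the first order term
  have hcomm : ∀ s : ℝ, ⟪Ψ₀, ((VP ∘L (U (-(t - s)) ∘L VO ∘L U (t - s))) -
      ((U (-(t - s)) ∘L VO ∘L U (t - s)) ∘L VP)) Ψ₀⟫_ℂ =
      ⟪U (t - s) (VP (U s Ψ₀)), VO Φ⟫_ℂ - ⟪VO Φ, U (t - s) (VP (U s Ψ₀))⟫_ℂ := by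
    intro s
    have hΦs : Φ = Complex.exp (-(Complex.I * E₀ * s)) • U (t - s) Ψ₀ := by
      rw [← map_smul, ← hgs s, hΦ]
      have := hUgrp (t - s) s
      rw [sub_add_cancel] at this
      rw [this]; rfl
    rw [hΦs, hgs s]
    simp only [map_smul, inner_smul_left, inner_smul_right, ContinuousLinearMap.sub_apply,
      ContinuousLinearMap.comp_apply, inner_sub_right]
    rw [← mul_assoc, ← mul_assoc, mul_comm (Complex.exp _), hph, one_mul, one_mul, ← hP, hadj,
      hadj, hO]
  have hfirst : ⟪Φ, VO δ⟫_ℂ + ⟪δ, VO Φ⟫_ℂ =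
      Complex.I * (ε : ℂ) * ∫ t' in Set.Ioc (0:ℝ) t,
          ((heaviside (t - t') * f t' : ℝ) : ℂ) *
            ⟪Ψ₀, ((VP ∘L (U (-(t - t')) ∘L VO ∘L U (t - t'))) -
              ((U (-(t - t')) ∘L VO ∘L U (t - t')) ∘L VP)) Ψ₀⟫_ℂ := by
    have hi := hint t _ (hUcont Ψ₀)
    have hJ : ⟪VO Φ, X⟫_ℂ = ∫ s in Set.Ioc (0:ℝ) t,
        ⟪VO Φ, ((f s : ℝ) : ℂ) • U (t - s) (VP (U s Ψ₀))⟫_ℂ := (integral_inner hi _).symm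
    have hJ' : ⟪X, VO Φ⟫_ℂ = ∫ s in Set.Ioc (0:ℝ) t,
        ⟪((f s : ℝ) : ℂ) • U (t - s) (VP (U s Ψ₀)), VO Φ⟫_ℂ := by
      rw [← inner_conj_symm, hJ, ← integral_conj]
      simp only [inner_conj_symm]
    have hI : ∫ t' in Set.Ioc (0:ℝ) t,
          ((heaviside (t - t') * f t' : ℝ) : ℂ) *
            ⟪Ψ₀, ((VP ∘L (U (-(t - t')) ∘L VO ∘L U (t - t'))) -
              ((U (-(t - t')) ∘L VO ∘L U (t - t')) ∘L VP)) Ψ₀⟫_ℂ =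
        ⟪X, VO Φ⟫_ℂ - ⟪VO Φ, X⟫_ℂ := by
      rw [hJ, hJ', ← integral_sub (hi.inner_const _) (hi.const_inner _)]
      refine setIntegral_congr_fun measurableSet_Ioc fun s hs => ?_
      simp only [hcomm, inner_smul_left, inner_smul_right, Complex.conj_ofReal]
      have : heaviside (t - s) = 1 := by simp [heaviside, hs.2]
      rw [this, one_mul, mul_sub]
    rw [hI, ← hO, hδ]
    simp only [inner_neg_left, inner_neg_right, inner_smul_left, inner_smul_right, map_mul,
      Complex.conj_I, Complex.conj_ofReal]
    ring
  rw [h0, ← hfirst]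
  have hΨt : Ψ ε t = Φ + D := by rw [hDdef]; abel
  have hdec : ⟪Ψ ε t, VO (Ψ ε t)⟫_ℂ - ⟪Φ, VO Φ⟫_ℂ - (⟪Φ, VO δ⟫_ℂ + ⟪δ, VO Φ⟫_ℂ) =
      ⟪Φ, VO (D - δ)⟫_ℂ + ⟪D - δ, VO Φ⟫_ℂ + ⟪D, VO D⟫_ℂ := by
    rw [hΨt]
    simp only [map_add, map_sub, inner_add_left, inner_add_right, inner_sub_left, inner_sub_right]
    ring
  have hib : ∀ x y : 𝓗, ‖⟪x, VO y⟫_ℂ‖ ≤ ‖VO‖ * (‖x‖ * ‖y‖) := fun x y =>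
    (norm_inner_le_norm _ _).trans (by
      calc ‖x‖ * ‖VO y‖ ≤ ‖x‖ * (‖VO‖ * ‖y‖) := by gcongr; exact hlin y
        _ = _ := by ring)
  rw [hdec]
  have e1 := hib Φ (D - δ)
  have e2 := hib (D - δ) Φ
  have e3 := hib D D
  rw [hΦn, one_mul] at e1
  rw [hΦn, mul_one] at e2
  have e4 : ‖VO‖ * ‖D - δ‖ ≤ ‖VO‖ * (2 * (|ε| * A) ^ 2) := by gcongr
  have e5 : ‖VO‖ * (‖D‖ * ‖D‖) ≤ ‖VO‖ * ((2 * (|ε| * A)) * (2 * (|ε| * A))) := by gcongr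
  have e6 : (|ε| * A) ^ 2 = ε ^ 2 * A ^ 2 := by rw [mul_pow, sq_abs]
  calc _ ≤ ‖⟪Φ, VO (D - δ)⟫_ℂ‖ + ‖⟪D - δ, VO Φ⟫_ℂ‖ + ‖⟪D, VO D⟫_ℂ‖ := norm_add₃_le
    _ ≤ 8 * ‖VO‖ * (|ε| * A) ^ 2 := by linarith
    _ ≤ _ := by rw [e6]; nlinarith [sq_nonneg ε]

end
end
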